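/- Let X ⊂ P^{a_1} × P^{a_2} be a finite set of points with the inclusion property with respect to π_1. Then X is arithmetically Cohen–Macaulay. -/

import Mathlib

noncomputable section

/-- Points of projective `m`-space over the field `k`. -/
abbrev Pt (k : Type) [Field k] (m : ℕ) := Projectivization k (Fin (m + 1) → k)

set_option synthInstance.maxHeartbeats 1000000 in
/-- An ideal `I` of a polynomial ring defines an *arithmetically Cohen–Macaulay* (ACM)
quotient if there is a regular sequence on `R/I`, consisting of elements of the irrelevant
maximal ideal (generated by the images of the variables), whose length equals the Krull
dimension of `R/I`.  For a graded quotient of a polynomial ring this says exactly that the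
depth of the irrelevant maximal ideal on `R/I` equals the Krull dimension, i.e. that `R/I`
is a Cohen–Macaulay ring. -/
def IsACM {k : Type} [Field k] {σ : Type} (I : Ideal (MvPolynomial σ k)) : Prop :=
  ∃ rs : List (MvPolynomial σ k ⧸ I),
    (∀ r ∈ rs,
      r ∈ Ideal.map (Ideal.Quotient.mk I)
            (Ideal.span (Set.range (MvPolynomial.X : σ → MvPolynomial σ k)))) ∧
    RingTheory.Sequence.IsRegular (MvPolynomial σ k ⧸ I) rs ∧
    (rs.length : WithBot ℕ∞) = ringKrullDim (MvPolynomial σ k ⧸ I)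

variable (k : Type) [Field k]

/-- The homogeneous (saturated) vanishing ideal of a set of points of `ℙ^m`:
all polynomials vanishing on the affine cone over the points. -/
def vanishP {m : ℕ} (Z : Set (Pt k m)) : Ideal (MvPolynomial (Fin (m + 1)) k) :=
  ⨅ (q : Pt k m) (_ : q ∈ Z) (s : k),
    RingHom.ker (MvPolynomial.eval (s • q.rep))

/-- The bihomogeneous (saturated) vanishing ideal of a set of points of `ℙ^a × ℙ^b`:
all polynomials vanishing on the multicone over the points. -/
def vanishP2 {a b : ℕ} (X : Set (Pt k a × Pt k b)) :
    Ideal (MvPolynomial (Fin (a + 1) ⊕ Fin (b + 1)) k) :=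
  ⨅ (p : Pt k a × Pt k b) (_ : p ∈ X) (s : k) (t : k),
    RingHom.ker (MvPolynomial.eval (Sum.elim (s • p.1.rep) (t • p.2.rep)))

/-- The `(⋆)`-property for a finite set of points in `ℙ^a × ℙ^b`. -/
def StarProp {a b : ℕ} (X : Set (Pt k a × Pt k b)) : Prop :=
  ∀ p ∈ X, ∀ q ∈ X, (p.1, q.2) ∈ X ∨ (q.1, p.2) ∈ X

/-- The image under `π₁` of the level set of `X ⊆ ℙ^a × ℙ^b` over a point `P ∈ ℙ^a`:
`π₁(X_i) = {Q : (P_i, Q) ∈ X}` when `P = P_i`. -/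
def levelImage2 {a b : ℕ} (X : Set (Pt k a × Pt k b)) (P : Pt k a) : Set (Pt k b) :=
  {q | (P, q) ∈ X}

/-- `X ⊆ ℙ^a × ℙ^b` has the *inclusion property* with respect to `π₁`: the images
`π₁(X_1), …, π₁(X_t)` of its level sets are totally ordered by inclusion and each of them
is ACM. -/
def InclusionProp2 {a b : ℕ} (X : Set (Pt k a × Pt k b)) : Prop :=
  (∀ P₁ P₂ : Pt k a,
    levelImage2 k X P₁ ⊆ levelImage2 k X P₂ ∨ levelImage2 k X P₂ ⊆ levelImage2 k X P₁) ∧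
  ∀ P ∈ Prod.fst '' X, IsACM (vanishP k (levelImage2 k X P))

open TensorProduct in
/-- Contraction of the first tensor factor along a linear functional. -/
def tensorContractLeft {V : Type} (B : Type) [AddCommGroup V] [Module k V] [AddCommGroup B] [Module k B]
    (φ : Module.Dual k V) : V ⊗[k] B →ₗ[k] B :=
  TensorProduct.lid k B ∘ₗ φ.rTensor B

open TensorProduct in
/-- The image of `W ⊗ J` in `V ⊗ B`. -/
abbrev tensorSub {V B : Type} [AddCommGroup V] [Module k V] [AddCommGroup B] [Module k B]
    (W : Submodule k V) (J : Submodule k B) : Submodule k (V ⊗[k] B) :=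
  Submodule.map₂ (TensorProduct.mk k V B) W J

section Contraction

open TensorProduct

variable {k} {V B : Type} [AddCommGroup V] [Module k V] [AddCommGroup B] [Module k B]

@[simp]
lemma tensorContractLeft_tmul (φ : Module.Dual k V) (v : V) (b : B) :
    tensorContractLeft k B φ (v ⊗ₜ b) = φ v • b := by
  simp [tensorContractLeft]

lemma tensorContractLeft_mem {W : Submodule k V} {J : Submodule k B} {x : V ⊗[k] B}
    (hx : x ∈ tensorSub k W J) (φ : Module.Dual k V) : tensorContractLeft k B φ x ∈ J := by
  have : tensorSub k W J ≤ J.comap (tensorContractLeft k B φ) :=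
    Submodule.map₂_le.2 fun v _ b hb => by simpa using J.smul_mem _ hb
  exact this hx

/-- An element of `W ⊗ B` all of whose contractions along functionals vanishing on `W'` lie
in `J` belongs to `W ⊗ J + W' ⊗ B`. -/
lemma mem_sup_of_tensorContractLeft_mem {W W' : Submodule k V} {J : Submodule k B}
    {x : V ⊗[k] B} (hx : x ∈ tensorSub k W ⊤)
    (h : ∀ φ : Module.Dual k V, W' ≤ LinearMap.ker φ → tensorContractLeft k B φ x ∈ J) :
    x ∈ tensorSub k W J ⊔ tensorSub k W' ⊤ := by
  classical
  let U := W.map W'.mkQ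
  obtain ⟨π, hπ⟩ := U.subtype.exists_leftInverse_of_injective U.ker_subtype
  let β := Module.Basis.ofVectorSpace k U
  let φ (i) : Module.Dual k V := β.coord i ∘ₗ π ∘ₗ W'.mkQ
  have hφ (i) : W' ≤ LinearMap.ker (φ i) := fun w hw => by
    simp [φ, (Submodule.Quotient.mk_eq_zero W').2 hw]
  choose e heW he using fun i => (β i).2
  have hsub (v) (hv : v ∈ W) : ∃ s : Finset _, ∀ t, s ⊆ t → v - ∑ i ∈ t, φ i v • e i ∈ W' := by
    let u : U := ⟨W'.mkQ v, Submodule.mem_map_of_mem hv⟩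
    have hu : π (W'.mkQ v) = u := LinearMap.congr_fun hπ u
    refine ⟨(β.repr u).support, fun t ht => ?_⟩
    rw [← Submodule.Quotient.mk_eq_zero, ← Submodule.mkQ_apply, map_sub, map_sum, sub_eq_zero]
    have : W'.mkQ v = ((∑ i ∈ t, β.repr u i • β i : U) : V ⧸ W') := by
      conv_lhs => rw [show W'.mkQ v = (u : V ⧸ W') from rfl, ← β.linearCombination_repr u]
      rw [Finsupp.linearCombination_apply, Finsupp.sum_of_support_subset _ ht _ (by simp)]
    rw [this]
    push_cast
    refine Finset.sum_congr rfl fun i _ => ?_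
    simp only [map_smul, he, φ, LinearMap.comp_apply, hu, Module.Basis.coord_apply]
  have key : ∃ s : Finset _, ∀ t, s ⊆ t →
      x - ∑ i ∈ t, e i ⊗ₜ tensorContractLeft k B (φ i) x ∈ tensorSub k W' ⊤ := by
    rw [tensorSub, Submodule.map₂_eq_span_image2] at hx
    refine Submodule.span_induction ?_ ?_ ?_ ?_ hx
    · rintro _ ⟨v, hv, b, -, rfl⟩
      obtain ⟨s, hs⟩ := hsub v hv
      refine ⟨s, fun t ht => ?_⟩
      have := Submodule.apply_mem_map₂ (TensorProduct.mk k V B) (hs t ht)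
        (Submodule.mem_top (x := b))
      simpa [sub_tmul, sum_tmul, smul_tmul] using this
    · exact ⟨∅, by simp⟩
    · rintro x y - - ⟨s, hs⟩ ⟨s', hs'⟩
      refine ⟨s ∪ s', fun t ht => ?_⟩
      have := add_mem (hs t (Finset.union_subset_left ht)) (hs' t (Finset.union_subset_right ht))
      simpa only [map_add, tmul_add, Finset.sum_add_distrib, add_sub_add_comm] using this
    · rintro c x - ⟨s, hs⟩
      refine ⟨s, fun t ht => ?_⟩
      have := Submodule.smul_mem _ c (hs t ht)
      simpa only [map_smul, tmul_smul, smul_sub, Finset.smul_sum] using this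
  obtain ⟨s, hs⟩ := key
  rw [← sub_add_cancel x (∑ i ∈ s, e i ⊗ₜ tensorContractLeft k B (φ i) x)]
  refine add_mem (Submodule.mem_sup_right (hs s subset_rfl)) (Submodule.mem_sup_left ?_)
  exact sum_mem fun i _ => Submodule.apply_mem_map₂ _ (heW i) (h _ (hφ i))

/-- An element of `V ⊗ B` whose contractions along functionals vanishing on `W n` lie in `J n`
belongs to the sum of the `W i ⊗ J (i + 1)` for `i < n` and `W n ⊗ B`. -/
lemma mem_iSup_sup_of_tensorContractLeft_mem {W : ℕ → Submodule k V} (hW0 : W 0 = ⊤)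
    {J : ℕ → Submodule k B} (hJ : Monotone J) {x : V ⊗[k] B}
    (h : ∀ n, ∀ φ : Module.Dual k V, W n ≤ LinearMap.ker φ → tensorContractLeft k B φ x ∈ J n) (n : ℕ) :
    x ∈ (⨆ i < n, tensorSub k (W i) (J (i + 1))) ⊔ tensorSub k (W n) ⊤ := by
  induction n with
  | zero =>
    rw [hW0, tensorSub, TensorProduct.map₂_mk_top_top_eq_top]
    simp
  | succ n ih =>
    obtain ⟨g, hg, y, hy, rfl⟩ := Submodule.mem_sup.1 ih
    have hgJ (φ) : tensorContractLeft k B φ g ∈ J (n + 1) := by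
      have : ⨆ i < n, tensorSub k (W i) (J (i + 1)) ≤ (J (n + 1)).comap (tensorContractLeft k B φ) :=
        iSup₂_le fun i hi x hx => hJ (by omega) (tensorContractLeft_mem hx φ)
      exact this hg
    have := mem_sup_of_tensorContractLeft_mem hy (J := J (n + 1)) fun φ hφ => by
      simpa using sub_mem (h (n + 1) φ hφ) (hgJ φ)
    have hle : (⨆ i < n, tensorSub k (W i) (J (i + 1))) ⊔ tensorSub k (W n) (J (n + 1)) ≤
        ⨆ i < n + 1, tensorSub k (W i) (J (i + 1)) :=
      sup_le (biSup_mono fun i hi => by omega)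
        (le_iSup₂_of_le (f := fun i (_ : i < n + 1) => tensorSub k (W i) (J (i + 1)))
          n n.lt_succ_self le_rfl)
    refine sup_le_sup_right hle _ ?_
    rw [sup_assoc]
    exact Submodule.add_mem_sup hg this

end Contraction

section Criterion

variable {k}

open MvPolynomial

/-- A quotient of dimension at most two on which two elements of the irrelevant ideal form a
regular sequence is arithmetically Cohen–Macaulay. -/
lemma isACM_of_regular_pair {σ : Type} {I : Ideal (MvPolynomial σ k)} {L M : MvPolynomial σ k}
    (hLX : L ∈ Ideal.span (Set.range (X : σ → MvPolynomial σ k)))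
    (hMX : M ∈ Ideal.span (Set.range (X : σ → MvPolynomial σ k)))
    (hL : ∀ f, L * f ∈ I → f ∈ I)
    (hM : ∀ f, M * f ∈ I ⊔ Ideal.span {L} → f ∈ I ⊔ Ideal.span {L})
    (hI : I ≤ RingHom.ker (eval (0 : σ → k)))
    (hdim : ringKrullDim (MvPolynomial σ k ⧸ I) ≤ 2) : IsACM I := by
  have hspan : Ideal.span (Set.range (X : σ → MvPolynomial σ k)) ≤
      RingHom.ker (eval (0 : σ → k)) := by
    rw [Ideal.span_le]
    rintro _ ⟨i, rfl⟩
    simp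
  have hIL : I ⊔ Ideal.span {L} ≤ RingHom.ker (eval (0 : σ → k)) :=
    sup_le hI ((Ideal.span_singleton_le_iff_mem _).2 (hspan hLX))
  let q := Ideal.Quotient.mk I
  have hmem (f) : q f ∈ Ideal.span {q L} ↔ f ∈ I ⊔ Ideal.span {L} := by
    rw [sup_comm, ← Ideal.mem_quotient_iff_mem_sup, Ideal.map_span, Set.image_singleton]
  refine ⟨[q L, q M], ?_, ⟨⟨?_⟩, ?_⟩, ?_⟩
  · simp only [List.mem_cons, List.not_mem_nil, or_false, forall_eq_or_imp, forall_eq]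
    exact ⟨Ideal.mem_map_of_mem _ hLX, Ideal.mem_map_of_mem _ hMX⟩
  · intro i hi
    rw [isSMulRegular_quotient_iff_mem_of_smul_mem]
    intro x
    obtain ⟨f, rfl⟩ := Ideal.Quotient.mk_surjective x
    match i, hi with
    | 0, _ =>
      have := hL f
      rw [← Ideal.Quotient.eq_zero_iff_mem, ← Ideal.Quotient.eq_zero_iff_mem, map_mul] at this
      simpa using this
    | 1, _ =>
      have := hM f
      rw [← hmem, ← hmem, map_mul] at this
      simpa using this
  · intro h
    have h1 : (1 : MvPolynomial σ k ⧸ I) ∈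
        (Ideal.ofList [q L, q M] • ⊤ : Submodule (MvPolynomial σ k ⧸ I) _) := h ▸ trivial
    have hle : Ideal.ofList [q L, q M] ≤
        RingHom.ker (Ideal.Quotient.lift I (eval (0 : σ → k)) hI) := by
      rw [Ideal.ofList, Ideal.span_le]
      intro x hx
      rcases (by simpa using hx : x = q L ∨ x = q M) with rfl | rfl
      · exact hspan hLX
      · exact hspan hMX
    have := hle (by simpa using h1)
    simp at this
  · refine le_antisymm ?_ hdim
    have h₁ : ringKrullDim (MvPolynomial σ k ⧸ I ⊔ Ideal.span {L}) + 1 ≤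
        ringKrullDim (MvPolynomial σ k ⧸ I) := by
      refine ringKrullDim_succ_le_of_surjective (r := q L)
        (Ideal.Quotient.factor le_sup_left) (Ideal.Quotient.factor_surjective _) ?_ ?_
      · rw [mem_nonZeroDivisors_iff_right]
        intro x hx
        obtain ⟨f, rfl⟩ := Ideal.Quotient.mk_surjective x
        rw [← map_mul, Ideal.Quotient.eq_zero_iff_mem, mul_comm] at hx
        exact Ideal.Quotient.eq_zero_iff_mem.2 (hL f hx)
      · exact Ideal.Quotient.eq_zero_iff_mem.2
          (Ideal.mem_sup_right (Ideal.mem_span_singleton_self L))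
    have h₂ : ringKrullDim k + 1 ≤ ringKrullDim (MvPolynomial σ k ⧸ I ⊔ Ideal.span {L}) := by
      refine ringKrullDim_succ_le_of_surjective (r := Ideal.Quotient.mk _ M)
        (Ideal.Quotient.lift _ (eval (0 : σ → k)) hIL) ?_ ?_ ?_
      · exact fun c => ⟨Ideal.Quotient.mk _ (C c), by simp⟩
      · rw [mem_nonZeroDivisors_iff_right]
        intro x hx
        obtain ⟨f, rfl⟩ := Ideal.Quotient.mk_surjective x
        rw [← map_mul, Ideal.Quotient.eq_zero_iff_mem, mul_comm] at hx
        exact Ideal.Quotient.eq_zero_iff_mem.2 (hM f hx)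
      · exact hspan hMX
    rw [ringKrullDim_eq_zero_of_field, zero_add] at h₂
    calc (([q L, q M].length : ℕ) : WithBot ℕ∞) = 1 + 1 := by simp; norm_num
      _ ≤ _ := by gcongr
      _ ≤ _ := h₁

/-- The Krull dimension of a quotient by a finite intersection is bounded by those of the
quotients by its members. -/
lemma ringKrullDim_quotient_le_of_finite_iInf {R ι : Type} [CommRing R] {s : Set ι}
    (hs : s.Finite) (J : ι → Ideal R) {n : ℕ} (h : ∀ i ∈ s, ringKrullDim (R ⧸ J i) ≤ n)
    {I : Ideal R} (hI : ⨅ i ∈ s, J i ≤ I) : ringKrullDim (R ⧸ I) ≤ n := by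
  rw [ringKrullDim_quotient]
  refine iSup_le fun l => ?_
  obtain ⟨i, hi, hle⟩ : ∃ i ∈ s, J i ≤ l.head.1.asIdeal := by
    have := hI.trans l.head.2
    rw [← hs.coe_toFinset] at this
    have := (Ideal.IsPrime.inf_le' (s := hs.toFinset) (f := J) l.head.1.2).1
      (by simpa [Finset.inf_eq_iInf] using this)
    simpa using this
  have := h i hi
  rw [ringKrullDim_quotient] at this
  refine le_trans ?_ this
  let l' : LTSeries (PrimeSpectrum.zeroLocus (R := R) (J i)) :=
    ⟨l.length, fun j => ⟨(l j).1, hle.trans (l.monotone (Fin.zero_le j))⟩, fun j => l.step j⟩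
  exact le_iSup (fun l : LTSeries _ => ((l.length : ℕ) : WithBot ℕ∞)) l'

/-- Over an infinite field some linear form vanishes at none of finitely many nonzero vectors. -/
lemma exists_linear_form_ne_zero [Infinite k] {n : ℕ} {S : Set (Fin n → k)} (hS : S.Finite)
    (h0 : ∀ v ∈ S, v ≠ 0) :
    ∃ L ∈ Ideal.span (Set.range (X : Fin n → MvPolynomial (Fin n) k)),
      ∃ ℓ : Module.Dual k (Fin n → k),
        (∀ v, eval v L = ℓ v) ∧ ∀ v ∈ S, ℓ v ≠ 0 := by
  have := hS.to_subtype
  obtain ⟨ℓ, hℓ⟩ := Module.exists_dual_forall_apply_ne_zero (K := k)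
    (fun v : S => (v : Fin n → k)) fun v => h0 _ v.2
  refine ⟨∑ i, C (ℓ (Pi.single i 1)) * X i, ?_, ℓ, fun v => ?_, fun v hv => hℓ ⟨v, hv⟩⟩
  · exact sum_mem fun i _ => Ideal.mul_mem_left _ _ (Ideal.subset_span ⟨i, rfl⟩)
  · conv_rhs => rw [pi_eq_sum_univ' v]
    simp [mul_comm]

/-- A polynomial vanishing on a punctured line vanishes on the whole line. -/
lemma eval_eq_zero_of_forall_ne [Infinite k] {σ : Type} {f : MvPolynomial σ k} {w v : σ → k}
    (h : ∀ s : k, s ≠ 0 → eval (w + s • v) f = 0) : eval w f = 0 := by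
  let φ := aeval (R := k) fun i => Polynomial.C (w i) + Polynomial.X * Polynomial.C (v i)
  let g : Polynomial k := φ f
  have hφ (s : k) (f) : (φ f).eval s = eval (w + s • v) f := by
    induction f using MvPolynomial.induction_on with
    | C a => simp [φ, algHom_C, Polynomial.algebraMap_eq]
    | add p q hp hq => simp [hp, hq]
    | mul_X p i hp =>
      rw [map_mul, Polynomial.eval_mul, hp]
      simp [φ, mul_comm s]
  have hg (s : k) : g.eval s = eval (w + s • v) f := hφ s f
  have : g = 0 := by
    refine Polynomial.eq_zero_of_infinite_isRoot g
      ((Set.finite_singleton (0 : k)).infinite_compl.mono fun s hs => ?_)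
    exact (hg s).trans (h s hs)
  simpa [this] using (hg 0).symm

/-- The coordinate ring of a product of two lines through the origin has dimension at most two. -/
lemma ringKrullDim_quotient_plane [Infinite k] {σ τ : Type} {v : σ → k} {w : τ → k} (hv : v ≠ 0)
    (hw : w ≠ 0) :
    ringKrullDim (MvPolynomial (σ ⊕ τ) k ⧸
      ⨅ (s : k) (t : k), RingHom.ker (eval (Sum.elim (s • v) (t • w)))) ≤ (2 : ℕ) := by
  let ψ : MvPolynomial (σ ⊕ τ) k →ₐ[k] MvPolynomial (Fin 2) k :=
    aeval (Sum.elim (fun i => C (v i) * X 0) fun j => C (w j) * X 1)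
  have hψ (x : Fin 2 → k) (f) : eval x (ψ f) = eval (Sum.elim (x 0 • v) (x 1 • w)) f := by
    induction f using MvPolynomial.induction_on with
    | C a => simp [ψ, algHom_C]
    | add p q hp hq => simp [hp, hq]
    | mul_X p i hp =>
      rw [map_mul, map_mul, hp]
      rcases i with i | i <;> simp [ψ, mul_comm]
  have hker : ⨅ (s : k) (t : k), RingHom.ker (eval (Sum.elim (s • v) (t • w))) =
      RingHom.ker ψ.toRingHom := by
    ext f
    simp only [Submodule.mem_iInf, RingHom.mem_ker, AlgHom.toRingHom_eq_coe, RingHom.coe_coe]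
    refine ⟨fun h => MvPolynomial.funext fun x => ?_, fun h s t => ?_⟩
    · rw [hψ, h, map_zero]
    · simpa [h] using (hψ ![s, t] f).symm
  have hsurj : Function.Surjective ψ := by
    rw [← AlgHom.range_eq_top, eq_top_iff, ← adjoin_range_X, Algebra.adjoin_le_iff]
    rintro _ ⟨j, rfl⟩
    obtain ⟨i, hi⟩ := Function.ne_iff.1 hv
    obtain ⟨i', hi'⟩ := Function.ne_iff.1 hw
    simp only [Pi.zero_apply] at hi hi'
    fin_cases j
    · refine ⟨C (v i)⁻¹ * X (.inl i), ?_⟩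
      simp [ψ, ← mul_assoc, ← C_mul, hi]
    · refine ⟨C (w i')⁻¹ * X (.inr i'), ?_⟩
      simp [ψ, ← mul_assoc, ← C_mul, hi']
  rw [hker, ringKrullDim_eq_of_ringEquiv (RingHom.quotientKerEquivOfSurjective (f := ψ.toRingHom) hsurj),
    ringKrullDim_of_isNoetherianRing]
  simp

end Criterion

section Multicone

variable {k}

open MvPolynomial TensorProduct

lemma mem_vanishP {m : ℕ} {Z : Set (Pt k m)} {f : MvPolynomial (Fin (m + 1)) k} :
    f ∈ vanishP k Z ↔ ∀ q ∈ Z, ∀ s : k, eval (s • q.rep) f = 0 := by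
  simp [vanishP, Submodule.mem_iInf]

lemma mem_vanishP2 {a b : ℕ} {X : Set (Pt k a × Pt k b)}
    {f : MvPolynomial (Fin (a + 1) ⊕ Fin (b + 1)) k} :
    f ∈ vanishP2 k X ↔
      ∀ p ∈ X, ∀ s t : k, eval (Sum.elim (s • p.1.rep) (t • p.2.rep)) f = 0 := by
  simp only [vanishP2, Submodule.mem_iInf, RingHom.mem_ker]

lemma vanishP_anti {m : ℕ} {Y Z : Set (Pt k m)} (h : Y ⊆ Z) : vanishP k Z ≤ vanishP k Y :=
  fun _ hf => mem_vanishP.2 fun q hq => mem_vanishP.1 hf q (h hq)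

/-- A form vanishing at no point of `Z` is a nonzerodivisor modulo the ideal of `Z`. -/
lemma mem_vanishP_of_mul_mem [Infinite k] {m : ℕ} {Z : Set (Pt k m)}
    {M f : MvPolynomial (Fin (m + 1)) k} {ℓ : Module.Dual k (Fin (m + 1) → k)}
    (hM : ∀ v, eval v M = ℓ v) (hZ : ∀ q ∈ Z, ℓ q.rep ≠ 0) (h : M * f ∈ vanishP k Z) :
    f ∈ vanishP k Z := by
  refine mem_vanishP.2 fun q hq => ?_
  have hne (s : k) (hs : s ≠ 0) : eval (s • q.rep) f = 0 := by
    have := mem_vanishP.1 h q hq s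
    rw [map_mul, hM, map_smul, smul_eq_mul, mul_eq_zero, mul_eq_zero] at this
    exact this.resolve_left (by simp [hs, hZ q hq])
  intro s
  rcases eq_or_ne s 0 with rfl | hs
  · exact eval_eq_zero_of_forall_ne (v := q.rep) fun s hs => by simpa using hne s hs
  · exact hne s hs

/-- A form on the first factor vanishing at no point of `X` is a nonzerodivisor modulo the ideal
of `X`. -/
lemma mem_vanishP2_of_rename_inl_mul_mem [Infinite k] {a b : ℕ} {X : Set (Pt k a × Pt k b)}
    {L : MvPolynomial (Fin (a + 1)) k} {ℓ : Module.Dual k (Fin (a + 1) → k)}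
    (hL : ∀ v, eval v L = ℓ v) (hX : ∀ p ∈ X, ℓ p.1.rep ≠ 0)
    {f : MvPolynomial (Fin (a + 1) ⊕ Fin (b + 1)) k}
    (h : rename Sum.inl L * f ∈ vanishP2 k X) : f ∈ vanishP2 k X := by
  refine mem_vanishP2.2 fun p hp => ?_
  have hne (s t : k) (hs : s ≠ 0) : eval (Sum.elim (s • p.1.rep) (t • p.2.rep)) f = 0 := by
    have := mem_vanishP2.1 h p hp s t
    rw [map_mul, eval_rename, Sum.elim_comp_inl, hL, map_smul, smul_eq_mul, mul_eq_zero,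
      mul_eq_zero] at this
    exact this.resolve_left (by simp [hs, hX p hp])
  intro s t
  rcases eq_or_ne s 0 with rfl | hs
  · refine eval_eq_zero_of_forall_ne (v := Sum.elim p.1.rep 0) fun s hs => ?_
    convert hne s t hs using 2
    congr 1
    ext (i | i) <;> simp
  · exact hne s t hs

lemma tensorEquivSum_tmul {σ τ : Type} (f : MvPolynomial σ k) (g : MvPolynomial τ k) :
    tensorEquivSum k σ τ k (f ⊗ₜ g) = rename Sum.inl f * rename Sum.inr g := by
  have hl : (tensorEquivSum k σ τ k).toAlgHom.comp Algebra.TensorProduct.includeLeft =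
      rename Sum.inl := by ext i; simp
  have hr : (tensorEquivSum k σ τ k).toAlgHom.comp Algebra.TensorProduct.includeRight =
      rename Sum.inr := by ext i; simp
  rw [← hl, ← hr]
  simp [← map_mul]

/-- Restricting a polynomial to a point of the second factor commutes with functionals on the
first factor. -/
lemma exists_slice {σ τ : Type} (y : τ → k) (x : MvPolynomial σ k ⊗[k] MvPolynomial τ k) :
    ∃ p : MvPolynomial σ k, (∀ φ, eval y (tensorContractLeft k _ φ x) = φ p) ∧
      ∀ v, eval v p = eval (Sum.elim v y) (tensorEquivSum k σ τ k x) := by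
  induction x with
  | zero => exact ⟨0, by simp⟩
  | tmul f g =>
    refine ⟨eval y g • f, fun φ => ?_, fun v => ?_⟩
    · simp [mul_comm]
    · rw [tensorEquivSum_tmul, map_mul, eval_rename, eval_rename]
      simp [mul_comm]
  | add f g hf hg =>
    obtain ⟨p, hp, hp'⟩ := hf
    obtain ⟨q, hq, hq'⟩ := hg
    exact ⟨p + q, by simp [*]⟩

lemma tensorContractLeft_one_tmul_mul {V B : Type} [CommRing V] [Algebra k V] [CommRing B]
    [Algebra k B] (φ : Module.Dual k V) (c : B) (x : V ⊗[k] B) :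
    tensorContractLeft k B φ ((1 ⊗ₜ c) * x) = c * tensorContractLeft k B φ x := by
  induction x with
  | zero => simp
  | tmul v b => simp
  | add x y hx hy => rw [mul_add, map_add, map_add, hx, hy, mul_add]

lemma tensorContractLeft_tmul_one_mul {V B : Type} [CommRing V] [Algebra k V] [CommRing B]
    [Algebra k B] {φ : Module.Dual k V} {c : V}
    (h : (Ideal.span {c}).restrictScalars k ≤ LinearMap.ker φ) (x : V ⊗[k] B) :
    tensorContractLeft k B φ ((c ⊗ₜ 1) * x) = 0 := by
  induction x with
  | zero => simp
  | tmul v b =>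
    have : φ (c * v) = 0 := h (Ideal.mul_mem_right _ _ (Ideal.mem_span_singleton_self c))
    simp [this]
  | add x y hx hy => rw [mul_add, map_add, hx, hy, add_zero]

/-- If the level sets over the first factor form a chain, a form on the second factor vanishing at
no point of `X` is a nonzerodivisor modulo the ideal of `X` and any form on the first factor. -/
lemma mem_sup_of_rename_inr_mul_mem [Infinite k] {a b : ℕ} {X : Set (Pt k a × Pt k b)}
    (hfin : X.Finite)
    (hchain : ∀ P₁ P₂ : Pt k a,
      levelImage2 k X P₁ ⊆ levelImage2 k X P₂ ∨ levelImage2 k X P₂ ⊆ levelImage2 k X P₁)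
    (L : MvPolynomial (Fin (a + 1)) k) {M : MvPolynomial (Fin (b + 1)) k}
    {ℓ : Module.Dual k (Fin (b + 1) → k)} (hM : ∀ v, eval v M = ℓ v)
    (hX : ∀ p ∈ X, ℓ p.2.rep ≠ 0) {f : MvPolynomial (Fin (a + 1) ⊕ Fin (b + 1)) k}
    (h : rename Sum.inr M * f ∈ vanishP2 k X ⊔ Ideal.span {rename Sum.inl L}) :
    f ∈ vanishP2 k X ⊔ Ideal.span {rename Sum.inl L} := by
  let e := tensorEquivSum k (Fin (a + 1)) (Fin (b + 1)) k
  have hsnd : (Prod.snd '' X).Finite := hfin.image _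
  have hsub (P) : levelImage2 k X P ⊆ Prod.snd '' X := fun Q hQ => ⟨_, hQ, rfl⟩
  let N := (Prod.snd '' X).ncard
  let T (n : ℕ) : Set (Pt k a) := {P | N < (levelImage2 k X P).ncard + n}
  let Y (n : ℕ) : Set (Pt k b) := {Q ∈ Prod.snd '' X | ∀ P ∈ T n, (P, Q) ∈ X}
  let W (n : ℕ) : Submodule k (MvPolynomial (Fin (a + 1)) k) :=
    (vanishP k (T n) ⊔ Ideal.span {L}).restrictScalars k
  let J (n : ℕ) : Submodule k (MvPolynomial (Fin (b + 1)) k) :=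
    (vanishP k (Y n)).restrictScalars k
  have hW0 : W 0 = ⊤ := by
    have hT : T 0 = ∅ := Set.eq_empty_of_forall_notMem fun P hP =>
      (Set.ncard_le_ncard (hsub P) hsnd).not_gt hP
    have : vanishP k (T 0) = ⊤ := by simp [vanishP, hT]
    simp [W, this]
  have hJ : Monotone J := fun m n hmn => vanishP_anti fun Q hQ =>
    ⟨hQ.1, fun P hP => hQ.2 P (lt_of_lt_of_le (show N < _ from hP) (by omega))⟩
  have hcontract (n) (φ : Module.Dual k _) (hφ : W n ≤ LinearMap.ker φ) :
      tensorContractLeft k _ φ (e.symm f) ∈ J n := by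
    refine mem_vanishP_of_mul_mem hM (fun Q hQ => ?_) (mem_vanishP.2 fun Q hQ t => ?_)
    · obtain ⟨p, hp, rfl⟩ := hQ.1
      exact hX p hp
    · obtain ⟨g, hg, r, hr, hgr⟩ := Submodule.mem_sup.1 h
      obtain ⟨c, rfl⟩ := Ideal.mem_span_singleton'.1 hr
      have hMf : (1 ⊗ₜ M) * e.symm f = e.symm g + (L ⊗ₜ 1) * e.symm c := by
        apply e.injective
        rw [map_add, map_mul, map_mul, tensorEquivSum_tmul, tensorEquivSum_tmul]
        simp [← hgr, mul_comm]
      have hLφ : (Ideal.span {L}).restrictScalars k ≤ LinearMap.ker φ :=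
        fun x hx => hφ (Ideal.mem_sup_right hx)
      obtain ⟨p, hp, hp'⟩ := exists_slice (t • Q.rep) (e.symm g)
      rw [← tensorContractLeft_one_tmul_mul, hMf, map_add,
        tensorContractLeft_tmul_one_mul hLφ, add_zero, hp]
      refine hφ (Ideal.mem_sup_left (mem_vanishP.2 fun P hP s => ?_))
      rw [hp']
      simpa [e] using mem_vanishP2.1 hg (P, Q) (hQ.2 P hP) s t
  have hspan := mem_iSup_sup_of_tensorContractLeft_mem hW0 hJ hcontract N
  let K : Submodule k (MvPolynomial (Fin (a + 1)) k ⊗[k] MvPolynomial (Fin (b + 1)) k) :=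
    ((vanishP2 k X ⊔ Ideal.span {rename Sum.inl L}).restrictScalars k).comap e.toLinearMap
  have hmul (n) (g : MvPolynomial (Fin (b + 1)) k)
      (hg : ∀ v ∈ vanishP k (T n), ∀ p ∈ X, ∀ s t : k,
        eval (s • p.1.rep) v * eval (t • p.2.rep) g = 0) (v) (hv : v ∈ W n) :
      v ⊗ₜ g ∈ K := by
    obtain ⟨u, hu, r, hr, rfl⟩ := Submodule.mem_sup.1 hv
    obtain ⟨c, rfl⟩ := Ideal.mem_span_singleton'.1 hr
    change e _ ∈ vanishP2 k X ⊔ Ideal.span {rename Sum.inl L}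
    rw [tensorEquivSum_tmul, map_add, add_mul, map_mul]
    refine add_mem (Ideal.mem_sup_left (mem_vanishP2.2 fun p hp s t => ?_))
      (Ideal.mem_sup_right (Ideal.mul_mem_right _ _
        (Ideal.mul_mem_left _ _ (Ideal.mem_span_singleton_self _))))
    simpa [eval_rename] using hg u hu p hp s t
  have hK : (⨆ i < N, tensorSub k (W i) (J (i + 1))) ⊔ tensorSub k (W N) ⊤ ≤ K := by
    refine sup_le (iSup₂_le fun i hi => Submodule.map₂_le.2 fun v hv g hg => ?_)
      (Submodule.map₂_le.2 fun v hv g _ => ?_)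
    · refine hmul i g (fun u hu p hp s t => ?_) v hv
      by_cases hT : p.1 ∈ T i
      · rw [mem_vanishP.1 hu _ hT, zero_mul]
      · refine mul_eq_zero_of_right _ (mem_vanishP.1 hg p.2 ⟨⟨p, hp, rfl⟩, fun P hP => ?_⟩ t)
        have hle : levelImage2 k X p.1 ⊆ levelImage2 k X P := by
          refine (hchain p.1 P).elim id fun h => ?_
          have hfinP := hsnd.subset (hsub p.1)
          refine (Set.eq_of_subset_of_ncard_le h ?_ hfinP).ge
          have h₁ : ¬ N < (levelImage2 k X p.1).ncard + i := hT
          have h₂ : N < (levelImage2 k X P).ncard + (i + 1) := hP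
          omega
        exact hle hp
    · refine hmul N g (fun u hu p hp s t => ?_) v hv
      have hT : p.1 ∈ T N := by
        have : 0 < (levelImage2 k X p.1).ncard :=
          (Set.ncard_pos (hsnd.subset (hsub p.1))).2 ⟨p.2, hp⟩
        change N < _ + N
        omega
      rw [mem_vanishP.1 hu _ hT, zero_mul]
  have hf : e (e.symm f) ∈ vanishP2 k X ⊔ Ideal.span {rename Sum.inl L} := hK hspan
  rwa [e.apply_symm_apply] at hf

lemma ringKrullDim_quotient_vanishP2_le [Infinite k] {a b : ℕ} {X : Set (Pt k a × Pt k b)}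
    (hfin : X.Finite) :
    ringKrullDim (MvPolynomial (Fin (a + 1) ⊕ Fin (b + 1)) k ⧸ vanishP2 k X) ≤ 2 :=
  ringKrullDim_quotient_le_of_finite_iInf (n := 2) hfin _
    (fun p _ => ringKrullDim_quotient_plane p.1.rep_nonzero p.2.rep_nonzero) le_rfl

end Multicone

/-- **Corollary (inclusion implies ACM).** A finite set of points `X ⊆ ℙ^{a₁} × ℙ^{a₂}` with
the inclusion property with respect to `π₁` is arithmetically Cohen–Macaulay. -/
theorem inclusion_implies_ACM [CharZero k] {a b : ℕ} (X : Set (Pt k a × Pt k b))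
    (hfin : X.Finite) (hne : X.Nonempty) (hinc : InclusionProp2 k X) :
    IsACM (vanishP2 k X) := by
  have hinf : Infinite k := CharZero.infinite k
  obtain ⟨L, hLX, ℓ, hL, hℓ⟩ := exists_linear_form_ne_zero (hfin.image fun p => p.1.rep)
    (by rintro _ ⟨p, -, rfl⟩; exact p.1.rep_nonzero)
  obtain ⟨M, hMX, μ, hM, hμ⟩ := exists_linear_form_ne_zero (hfin.image fun p => p.2.rep)
    (by rintro _ ⟨p, -, rfl⟩; exact p.2.rep_nonzero)
  have hrename {σ τ : Type} (r : σ → τ) {f : MvPolynomial σ k}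
      (hf : f ∈ Ideal.span (Set.range (MvPolynomial.X : σ → MvPolynomial σ k))) :
      MvPolynomial.rename r f ∈
        Ideal.span (Set.range (MvPolynomial.X : τ → MvPolynomial τ k)) := by
    have := Ideal.mem_map_of_mem (MvPolynomial.rename r) hf
    rw [Ideal.map_span] at this
    refine Ideal.span_mono ?_ this
    rintro _ ⟨_, ⟨i, rfl⟩, rfl⟩
    exact ⟨r i, by simp⟩
  refine isACM_of_regular_pair (hrename Sum.inl hLX) (hrename Sum.inr hMX)
    (fun f hf => mem_vanishP2_of_rename_inl_mul_mem hL (fun p hp => hℓ _ ⟨p, hp, rfl⟩) hf)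
    (fun f hf => mem_sup_of_rename_inr_mul_mem hfin hinc.1 L hM
      (fun p hp => hμ _ ⟨p, hp, rfl⟩) hf) (fun f hf => ?_)
    (ringKrullDim_quotient_vanishP2_le hfin)
  obtain ⟨p, hp⟩ := hne
  simpa using mem_vanishP2.1 hf p hp 0 0

end
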